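/- arXiv:2310.02745 — 7 statements merged into one kernel-verified Lean document; each statement's English description precedes it below -/
import Mathlib

section
/- Let z̄ be the unique minimizer of s over [0,∞)^m and set ϑ̄ := (Dᵀ)⁻¹(z̄ + B). Then the vector D⁻¹ϑ̄ (which equals the gradient ∇s(z̄) = (DᵀD)⁻¹(z̄ + B)) has all components nonnegative, and the complementary slackness condition z̄ · (D⁻¹ϑ̄) = 0 holds. -/
open Matrix Finset

theorem aux_scalar (p q : ℝ) (hq : 0 ≤ q)
    (h : ∀ t : ℝ, 0 ≤ t → t ≤ 1 → 0 ≤ 2 * t * p + t ^ 2 * q) : 0 ≤ p := by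
  by_contra hp
  push Not at hp
  have hqp : 0 < q - p := by linarith
  have h1 := h (-p / (q - p)) (div_nonneg (by linarith) hqp.le)
    ((div_le_one hqp).2 (by linarith))
  have h2 : 2 * (-p / (q - p)) * p + (-p / (q - p)) ^ 2 * q
      = (p ^ 2 * (2 * p - q)) / (q - p) ^ 2 := by
    field_simp
    ring
  rw [h2] at h1
  have h3 : (p ^ 2 * (2 * p - q)) / (q - p) ^ 2 < 0 := by
    apply div_neg_of_neg_of_pos
    · exact mul_neg_of_pos_of_neg (by nlinarith) (by linarith)
    · positivity
  linarith

theorem kkt_of_minimizer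
    (m : ℕ) (hm : 1 ≤ m)
    (D : Matrix (Fin m) (Fin m) ℝ) (hD : IsUnit D.det)
    (B : Fin m → ℝ) (hB : ∀ i, 0 ≤ B i)
    (zbar : Fin m → ℝ) (hzbar : ∀ i, 0 ≤ zbar i)
    (hmin : ∀ z : Fin m → ℝ, (∀ i, 0 ≤ z i) →
      (1/2) * ∑ i, ((Dᵀ)⁻¹ *ᵥ (zbar + B)) i ^ 2 ≤
        (1/2) * ∑ i, ((Dᵀ)⁻¹ *ᵥ (z + B)) i ^ 2)
    (huniq : ∀ z : Fin m → ℝ, (∀ i, 0 ≤ z i) →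
      ((1/2) * ∑ i, ((Dᵀ)⁻¹ *ᵥ (z + B)) i ^ 2 =
        (1/2) * ∑ i, ((Dᵀ)⁻¹ *ᵥ (zbar + B)) i ^ 2) → z = zbar) :
    (∀ i, 0 ≤ (D⁻¹ *ᵥ ((Dᵀ)⁻¹ *ᵥ (zbar + B))) i) ∧
    (D⁻¹ *ᵥ ((Dᵀ)⁻¹ *ᵥ (zbar + B)) = (Dᵀ * D)⁻¹ *ᵥ (zbar + B)) ∧
    ∑ i, zbar i * (D⁻¹ *ᵥ ((Dᵀ)⁻¹ *ᵥ (zbar + B))) i = 0 := by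
  have key : ∀ w : Fin m → ℝ, (∀ i, 0 ≤ zbar i + w i) →
      0 ≤ ∑ i, w i * (D⁻¹ *ᵥ ((Dᵀ)⁻¹ *ᵥ (zbar + B))) i := by
    intro w hw
    have e : ∑ i, w i * (D⁻¹ *ᵥ ((Dᵀ)⁻¹ *ᵥ (zbar + B))) i
        = ∑ i, ((Dᵀ)⁻¹ *ᵥ w) i * ((Dᵀ)⁻¹ *ᵥ (zbar + B)) i := by
      change w ⬝ᵥ (D⁻¹ *ᵥ ((Dᵀ)⁻¹ *ᵥ (zbar + B))) = ((Dᵀ)⁻¹ *ᵥ w) ⬝ᵥ ((Dᵀ)⁻¹ *ᵥ (zbar + B))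
      rw [Matrix.dotProduct_mulVec w, ← Matrix.transpose_nonsing_inv, Matrix.mulVec_transpose D⁻¹ w]
    rw [e]
    apply aux_scalar _ (∑ i, ((Dᵀ)⁻¹ *ᵥ w) i ^ 2) (Finset.sum_nonneg fun i _ => sq_nonneg _)
    intro t ht0 ht1
    have h1 := hmin (zbar + t • w) (fun i => by
      simp only [Pi.add_apply, Pi.smul_apply, smul_eq_mul]
      nlinarith [hw i, hzbar i, mul_nonneg ht0 (hw i), mul_nonneg (sub_nonneg.2 ht1) (hzbar i)])
    have h2 : ∑ i, ((Dᵀ)⁻¹ *ᵥ (zbar + t • w + B)) i ^ 2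
        = ∑ i, ((Dᵀ)⁻¹ *ᵥ (zbar + B)) i ^ 2
          + (2 * t * ∑ i, ((Dᵀ)⁻¹ *ᵥ w) i * ((Dᵀ)⁻¹ *ᵥ (zbar + B)) i
          + t ^ 2 * ∑ i, ((Dᵀ)⁻¹ *ᵥ w) i ^ 2) := by
      rw [add_right_comm, Matrix.mulVec_add, Matrix.mulVec_smul, Finset.mul_sum, Finset.mul_sum,
        ← Finset.sum_add_distrib, ← Finset.sum_add_distrib]
      refine Finset.sum_congr rfl fun i _ => ?_
      simp only [Pi.add_apply, Pi.smul_apply, smul_eq_mul]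
      ring
    linarith
  have pos : ∀ i, 0 ≤ (D⁻¹ *ᵥ ((Dᵀ)⁻¹ *ᵥ (zbar + B))) i := by
    intro i
    have h := key (Pi.single i 1) (fun j => add_nonneg (hzbar j) (by
      by_cases hj : j = i
      · subst hj; simp
      · simp [hj]))
    change 0 ≤ Pi.single i 1 ⬝ᵥ _ at h
    rwa [single_dotProduct, one_mul] at h
  refine ⟨pos, ?_, ?_⟩
  · rw [Matrix.mul_inv_rev, Matrix.mulVec_mulVec]
  · apply le_antisymm
    · have h := key (-zbar) (fun i => by simp)
      simp only [Pi.neg_apply, neg_mul, Finset.sum_neg_distrib] at h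
      linarith
    · exact Finset.sum_nonneg fun i _ => mul_nonneg (hzbar i) (pos i)
end

section
/- Let z̄ be the unique minimizer of s over [0,∞)^m and set ϑ̄ := (Dᵀ)⁻¹(z̄ + B). Then ((Dᵀ)⁻¹B) · ϑ̄ = ‖ϑ̄‖². -/
open Matrix Finset

theorem inner_theta_identity
    (m : ℕ) (hm : 1 ≤ m)
    (D : Matrix (Fin m) (Fin m) ℝ) (hD : IsUnit D.det)
    (B : Fin m → ℝ) (hB : ∀ i, 0 ≤ B i)
    (zbar : Fin m → ℝ) (hzbar : ∀ i, 0 ≤ zbar i)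
    (hmin : ∀ z : Fin m → ℝ, (∀ i, 0 ≤ z i) →
      (1/2) * ∑ i, ((Dᵀ)⁻¹ *ᵥ (zbar + B)) i ^ 2 ≤
        (1/2) * ∑ i, ((Dᵀ)⁻¹ *ᵥ (z + B)) i ^ 2)
    (huniq : ∀ z : Fin m → ℝ, (∀ i, 0 ≤ z i) →
      ((1/2) * ∑ i, ((Dᵀ)⁻¹ *ᵥ (z + B)) i ^ 2 =
        (1/2) * ∑ i, ((Dᵀ)⁻¹ *ᵥ (zbar + B)) i ^ 2) → z = zbar) :
    ∑ i, ((Dᵀ)⁻¹ *ᵥ B) i * ((Dᵀ)⁻¹ *ᵥ (zbar + B)) i =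
      ∑ i, ((Dᵀ)⁻¹ *ᵥ (zbar + B)) i ^ 2 := by
  set A := (Dᵀ)⁻¹ with hA
  set u := A *ᵥ zbar with hu
  set b := A *ᵥ B with hb
  have hθ : A *ᵥ (zbar + B) = u + b := by rw [Matrix.mulVec_add]
  have key : ∀ t : ℝ, -1 ≤ t →
      0 ≤ 2 * t * (∑ i, u i * (u i + b i)) + t ^ 2 * ∑ i, u i ^ 2 := by
    intro t ht
    have h := hmin ((1 + t) • zbar) (fun i => by
      simp only [Pi.smul_apply, smul_eq_mul]
      exact mul_nonneg (by linarith) (hzbar i))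
    rw [hθ, Matrix.mulVec_add, Matrix.mulVec_smul] at h
    have e : ∑ i, ((1 + t) • A *ᵥ zbar + A *ᵥ B) i ^ 2 = ∑ i, (u + b) i ^ 2 +
        (2 * t * (∑ i, u i * (u i + b i)) + t ^ 2 * ∑ i, u i ^ 2) := by
      rw [Finset.mul_sum, Finset.mul_sum, ← Finset.sum_add_distrib, ← Finset.sum_add_distrib]
      refine Finset.sum_congr rfl fun i _ => ?_
      simp only [Pi.add_apply, Pi.smul_apply, smul_eq_mul, ← hu, ← hb]
      ring
    rw [e] at h
    linarith
  have hQ : 0 ≤ ∑ i, u i ^ 2 := Finset.sum_nonneg fun i _ => sq_nonneg _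
  have hP : ∑ i, u i * (u i + b i) = 0 := by
    generalize (∑ i, u i * (u i + b i)) = P at *
    generalize (∑ i, u i ^ 2) = Q at *
    by_contra hne
    have hR : 0 < Q + |P| + 1 := by positivity
    have h := key (-P / (Q + |P| + 1)) (by
      rw [le_div_iff₀ hR]
      linarith [le_abs_self P])
    have e : 2 * (-P / (Q + |P| + 1)) * P + (-P / (Q + |P| + 1)) ^ 2 * Q =
        -(P ^ 2 * (Q + 2 * |P| + 2) / (Q + |P| + 1) ^ 2) := by
      field_simp
      ring
    rw [e] at h
    have : 0 < P ^ 2 * (Q + 2 * |P| + 2) / (Q + |P| + 1) ^ 2 := by positivity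
    linarith
  rw [hθ]
  have e : ∑ i, (u + b) i ^ 2 = ∑ i, b i * (u + b) i + ∑ i, u i * (u i + b i) := by
    rw [← Finset.sum_add_distrib]
    refine Finset.sum_congr rfl fun i _ => ?_
    simp only [Pi.add_apply]
    ring
  rw [e, hP, add_zero]
end

section
/- Let α > 0 and define h(z) := (1/2) zᵀDᵀD z − α (B · z) for z ∈ ℝ^m. Then the vector α D⁻¹ϑ̄ lies in [0,∞)^m, it is the unique minimizer of h over [0,∞)^m, and the minimum value is h(α D⁻¹ϑ̄) = −(1/2) α² ‖ϑ̄‖². -/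
open Matrix Finset

theorem h_min_pos_alpha
    (m : ℕ) (hm : 1 ≤ m)
    (D : Matrix (Fin m) (Fin m) ℝ) (hD : IsUnit D.det)
    (B : Fin m → ℝ) (hB : ∀ i, 0 ≤ B i)
    (zbar : Fin m → ℝ) (hzbar : ∀ i, 0 ≤ zbar i)
    (hmin : ∀ z : Fin m → ℝ, (∀ i, 0 ≤ z i) →
      (1/2) * ∑ i, ((Dᵀ)⁻¹ *ᵥ (zbar + B)) i ^ 2 ≤
        (1/2) * ∑ i, ((Dᵀ)⁻¹ *ᵥ (z + B)) i ^ 2)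
    (huniq : ∀ z : Fin m → ℝ, (∀ i, 0 ≤ z i) →
      ((1/2) * ∑ i, ((Dᵀ)⁻¹ *ᵥ (z + B)) i ^ 2 =
        (1/2) * ∑ i, ((Dᵀ)⁻¹ *ᵥ (zbar + B)) i ^ 2) → z = zbar)
    (α : ℝ) (hα : 0 < α)
    (h : (Fin m → ℝ) → ℝ)
    (hdef : ∀ z : Fin m → ℝ,
      h z = (1/2) * ∑ i, (D *ᵥ z) i ^ 2 - α * ∑ i, B i * z i) :
    (∀ i, 0 ≤ (α • (D⁻¹ *ᵥ ((Dᵀ)⁻¹ *ᵥ (zbar + B)))) i) ∧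
    (∀ z : Fin m → ℝ, (∀ i, 0 ≤ z i) →
      h (α • (D⁻¹ *ᵥ ((Dᵀ)⁻¹ *ᵥ (zbar + B)))) ≤ h z) ∧
    (∀ z : Fin m → ℝ, (∀ i, 0 ≤ z i) →
      h z = h (α • (D⁻¹ *ᵥ ((Dᵀ)⁻¹ *ᵥ (zbar + B)))) →
      z = α • (D⁻¹ *ᵥ ((Dᵀ)⁻¹ *ᵥ (zbar + B)))) ∧
    h (α • (D⁻¹ *ᵥ ((Dᵀ)⁻¹ *ᵥ (zbar + B)))) =
      -(1/2) * α ^ 2 * ∑ i, ((Dᵀ)⁻¹ *ᵥ (zbar + B)) i ^ 2 := by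
  have hDT : IsUnit (Dᵀ).det := by rwa [Matrix.det_transpose]
  have hsq : ∀ v : Fin m → ℝ, ∑ i, v i ^ 2 = v ⬝ᵥ v := fun v => by
    simp [dotProduct, sq]
  have hBd : ∀ v : Fin m → ℝ, ∑ i, B i * v i = B ⬝ᵥ v := fun v => rfl
  simp only [hsq, hBd] at hmin huniq hdef ⊢
  obtain ⟨θ, hθ⟩ : ∃ θ, θ = (Dᵀ)⁻¹ *ᵥ (zbar + B) := ⟨_, rfl⟩
  obtain ⟨w, hw⟩ : ∃ w, w = D⁻¹ *ᵥ θ := ⟨_, rfl⟩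
  have hDw : D *ᵥ w = θ := by
    rw [hw, mulVec_mulVec, Matrix.mul_nonsing_inv _ hD, one_mulVec]
  have hDθ : Dᵀ *ᵥ θ = zbar + B := by
    rw [hθ, mulVec_mulVec, Matrix.mul_nonsing_inv _ hDT, one_mulVec]
  -- adjointness
  have hadj : ∀ d : Fin m → ℝ, θ ⬝ᵥ ((Dᵀ)⁻¹ *ᵥ d) = w ⬝ᵥ d := fun d => by
    rw [dotProduct_mulVec, hw, ← Matrix.transpose_nonsing_inv, vecMul_transpose]
  have hadj2 : ∀ y : Fin m → ℝ, θ ⬝ᵥ (D *ᵥ y) = zbar ⬝ᵥ y + B ⬝ᵥ y := fun y => by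
    rw [dotProduct_mulVec, ← mulVec_transpose, hDθ, add_dotProduct]
  -- variational inequality
  have hvar : ∀ d : Fin m → ℝ, (∀ t : ℝ, 0 < t → t ≤ 1 → ∀ i, 0 ≤ (zbar + t • d) i) →
      0 ≤ w ⬝ᵥ d := by
    intro d hd
    set q := ((Dᵀ)⁻¹ *ᵥ d) ⬝ᵥ ((Dᵀ)⁻¹ *ᵥ d) with hq
    have hq0 : 0 ≤ q := by
      rw [hq, ← hsq]; exact Finset.sum_nonneg fun i _ => sq_nonneg _
    have key : ∀ t : ℝ, 0 < t → t ≤ 1 → 0 ≤ 2 * (w ⬝ᵥ d) + t * q := by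
      intro t ht ht1
      have h1 := hmin _ (hd t ht ht1)
      have h2 : (Dᵀ)⁻¹ *ᵥ (zbar + t • d + B) = θ + t • ((Dᵀ)⁻¹ *ᵥ d) := by
        rw [hθ, ← mulVec_smul, ← mulVec_add]; congr 1; abel
      rw [h2, ← hθ] at h1
      simp only [add_dotProduct, dotProduct_add, smul_dotProduct, dotProduct_smul, smul_eq_mul,
        dotProduct_comm ((Dᵀ)⁻¹ *ᵥ d) θ, hadj, ← hq] at h1
      have h3 : 0 ≤ t * (2 * (w ⬝ᵥ d) + t * q) := by linarith
      exact nonneg_of_mul_nonneg_right h3 ht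
    by_contra hneg
    push Not at hneg
    have h1 := key 1 one_pos le_rfl
    have hqp : 0 < q := by linarith
    have h2 := key (-(w ⬝ᵥ d) / q) (div_pos (by linarith) hqp)
      (by rw [div_le_one hqp]; linarith)
    rw [div_mul_cancel₀ _ hqp.ne'] at h2
    linarith
  have hwn : ∀ i, 0 ≤ w i := by
    intro i
    have := hvar (Pi.single i 1) (fun t ht _ j => by
      have : (0:ℝ) ≤ (Pi.single i (1:ℝ) : Fin m → ℝ) j := by
        by_cases hij : j = i
        · subst hij; simp
        · simp [hij]
      have := mul_nonneg ht.le this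
      have := hzbar j
      simp only [Pi.add_apply, Pi.smul_apply, smul_eq_mul]
      linarith)
    simpa using this
  have hwz : w ⬝ᵥ zbar = 0 := by
    have h1 := hvar (-zbar) (fun t ht ht1 j => by
      have := mul_nonneg (sub_nonneg.2 ht1) (hzbar j)
      simp only [Pi.add_apply, Pi.smul_apply, Pi.neg_apply, smul_eq_mul]
      linarith)
    have h2 : 0 ≤ w ⬝ᵥ zbar := Finset.sum_nonneg fun i _ => mul_nonneg (hwn i) (hzbar i)
    rw [dotProduct_neg] at h1
    linarith
  rw [← hθ, ← hw]
  have hBw : B ⬝ᵥ w = θ ⬝ᵥ θ := by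
    have := hadj2 w
    rw [hDw, dotProduct_comm zbar w, hwz] at this
    linarith
  have hval : h (α • w) = -(1/2) * α ^ 2 * (θ ⬝ᵥ θ) := by
    rw [hdef, mulVec_smul, hDw]
    simp only [smul_dotProduct, dotProduct_smul, smul_eq_mul, hBw]
    ring
  have hdiff : ∀ z : Fin m → ℝ, h z = h (α • w) + α * (zbar ⬝ᵥ z)
      + (1/2) * ((D *ᵥ (z - α • w)) ⬝ᵥ (D *ᵥ (z - α • w))) := by
    intro z
    have h1 := hadj2 z
    rw [hval, hdef, mulVec_sub, mulVec_smul, hDw]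
    simp only [sub_dotProduct, dotProduct_sub, smul_dotProduct, dotProduct_smul, smul_eq_mul,
      dotProduct_comm (D *ᵥ z) θ, h1]
    ring
  have hzz : ∀ z : Fin m → ℝ, (∀ i, 0 ≤ z i) → 0 ≤ α * (zbar ⬝ᵥ z) := fun z hz =>
    mul_nonneg hα.le (Finset.sum_nonneg fun i _ => mul_nonneg (hzbar i) (hz i))
  have hnn : ∀ v : Fin m → ℝ, 0 ≤ v ⬝ᵥ v := fun v => by
    rw [← hsq]; exact Finset.sum_nonneg fun i _ => sq_nonneg _
  refine ⟨fun i => mul_nonneg hα.le (hwn i), fun z hz => ?_, fun z hz he => ?_, hval⟩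
  · have := hdiff z
    have := hzz z hz
    have := hnn (D *ᵥ (z - α • w))
    linarith
  · have h1 := hdiff z
    have h2 := hzz z hz
    have h3 := hnn (D *ᵥ (z - α • w))
    have h4 : (D *ᵥ (z - α • w)) ⬝ᵥ (D *ᵥ (z - α • w)) = 0 := by linarith
    have h5 := dotProduct_self_eq_zero.1 h4
    have h6 := Matrix.eq_zero_of_mulVec_eq_zero hD.ne_zero h5
    exact sub_eq_zero.1 h6
end

section
/- Let P₁ > 0 and c < 0 be real numbers. Then the function u ↦ P₁ · uᵀDᵀD u + 2 P₁ c (B · u) attains its minimum over the nonnegative orthant [0,∞)^m uniquely at u* = −c D⁻¹ϑ̄ (which lies in [0,∞)^m), and the minimum value equals −P₁ c² ‖ϑ̄‖². -/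
open Matrix Finset

theorem aux_first_order (a b : ℝ) (hb : 0 ≤ b)
    (h : ∀ e : ℝ, 0 < e → e ≤ 1 → 0 ≤ 2 * e * a + e ^ 2 * b) : 0 ≤ a := by
  by_contra! ha
  have hd : 0 < b - a := by linarith
  have he : 0 < -a / (b - a) := div_pos (by linarith) hd
  have h1 : -a / (b - a) ≤ 1 := by
    rw [div_le_one hd]; linarith
  have h2 := h _ he h1
  have h3 : (-a / (b - a)) * (b - a) = -a := div_mul_cancel₀ _ hd.ne'
  generalize -a / (b - a) = e at *
  have h4 : 0 ≤ e * (2 * a + e * b) := by nlinarith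
  have h5 : 0 ≤ 2 * a + e * b := nonneg_of_mul_nonneg_right h4 he
  nlinarith

theorem aux_sum_sq {m : ℕ} (x : Fin m → ℝ) : ∑ i, x i ^ 2 = x ⬝ᵥ x := by
  simp [dotProduct, sq]

theorem quadratic_min_over_orthant
    (m : ℕ) (hm : 1 ≤ m)
    (D : Matrix (Fin m) (Fin m) ℝ) (hD : IsUnit D.det)
    (B : Fin m → ℝ) (hB : ∀ i, 0 ≤ B i)
    (zbar : Fin m → ℝ) (hzbar : ∀ i, 0 ≤ zbar i)
    (hmin : ∀ z : Fin m → ℝ, (∀ i, 0 ≤ z i) →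
      (1/2) * ∑ i, ((Dᵀ)⁻¹ *ᵥ (zbar + B)) i ^ 2 ≤
        (1/2) * ∑ i, ((Dᵀ)⁻¹ *ᵥ (z + B)) i ^ 2)
    (huniq : ∀ z : Fin m → ℝ, (∀ i, 0 ≤ z i) →
      ((1/2) * ∑ i, ((Dᵀ)⁻¹ *ᵥ (z + B)) i ^ 2 =
        (1/2) * ∑ i, ((Dᵀ)⁻¹ *ᵥ (zbar + B)) i ^ 2) → z = zbar)
    (P₁ c : ℝ) (hP₁ : 0 < P₁) (hc : c < 0)
    (f : (Fin m → ℝ) → ℝ)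
    (hf : ∀ u : Fin m → ℝ,
      f u = P₁ * ∑ i, (D *ᵥ u) i ^ 2 + 2 * P₁ * c * ∑ i, B i * u i) :
    (∀ i, 0 ≤ ((-c) • (D⁻¹ *ᵥ ((Dᵀ)⁻¹ *ᵥ (zbar + B)))) i) ∧
    (∀ u : Fin m → ℝ, (∀ i, 0 ≤ u i) →
      f ((-c) • (D⁻¹ *ᵥ ((Dᵀ)⁻¹ *ᵥ (zbar + B)))) ≤ f u) ∧
    (∀ u : Fin m → ℝ, (∀ i, 0 ≤ u i) →
      f u = f ((-c) • (D⁻¹ *ᵥ ((Dᵀ)⁻¹ *ᵥ (zbar + B)))) →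
      u = (-c) • (D⁻¹ *ᵥ ((Dᵀ)⁻¹ *ᵥ (zbar + B)))) ∧
    f ((-c) • (D⁻¹ *ᵥ ((Dᵀ)⁻¹ *ᵥ (zbar + B)))) =
      -P₁ * c ^ 2 * ∑ i, ((Dᵀ)⁻¹ *ᵥ (zbar + B)) i ^ 2 := by
  set t := (Dᵀ)⁻¹ *ᵥ (zbar + B) with ht
  set v := D⁻¹ *ᵥ t with hv
  have hDT : IsUnit (Dᵀ).det := by rwa [det_transpose]
  have hDv : D *ᵥ v = t := by
    rw [hv, mulVec_mulVec, mul_nonsing_inv _ hD, one_mulVec]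
  have hDt : Dᵀ *ᵥ t = zbar + B := by
    rw [ht, mulVec_mulVec, mul_nonsing_inv _ hDT, one_mulVec]
  have hdir : ∀ w : Fin m → ℝ, (∀ i, 0 ≤ zbar i + w i) → 0 ≤ v ⬝ᵥ w := by
    intro w hw
    have hvw : v ⬝ᵥ w = t ⬝ᵥ ((Dᵀ)⁻¹ *ᵥ w) := by
      rw [hv, ← transpose_nonsing_inv, mulVec_transpose, dotProduct_comm t,
        ← dotProduct_mulVec, dotProduct_comm]
    rw [hvw]
    set y := (Dᵀ)⁻¹ *ᵥ w with hy
    apply aux_first_order _ (y ⬝ᵥ y)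
    · rw [← aux_sum_sq]; positivity
    · intro e he he1
      have h := hmin (zbar + e • w) (by
        intro i
        have h1 := hw i
        have h2 := hzbar i
        simp only [Pi.add_apply, Pi.smul_apply, smul_eq_mul]
        nlinarith)
      have h3 : (Dᵀ)⁻¹ *ᵥ (zbar + e • w + B) = t + e • y := by
        rw [ht, hy, ← mulVec_smul, ← mulVec_add]; congr 1; abel
      rw [h3, aux_sum_sq, aux_sum_sq] at h
      simp only [add_dotProduct, dotProduct_add, smul_dotProduct, dotProduct_smul,
        smul_eq_mul, dotProduct_comm y t] at h
      nlinarith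
  have hvn : ∀ i, 0 ≤ v i := by
    intro i
    have h := hdir (Pi.single i 1) (by
      intro j
      have h1 : (0 : Fin m → ℝ) ≤ Pi.single i (1 : ℝ) := Pi.single_nonneg.2 zero_le_one
      exact add_nonneg (hzbar j) (h1 j))
    simpa using h
  have hvz : zbar ⬝ᵥ v = 0 := by
    have h := hdir (-zbar) (by intro i; simp)
    rw [dotProduct_neg, dotProduct_comm] at h
    have h2 : 0 ≤ zbar ⬝ᵥ v := Finset.sum_nonneg fun i _ => mul_nonneg (hzbar i) (hvn i)
    linarith
  have hfu : ∀ u, f u = P₁ * ∑ i, (D *ᵥ u + c • t) i ^ 2 - P₁ * c ^ 2 * ∑ i, t i ^ 2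
      - 2 * P₁ * c * (zbar ⬝ᵥ u) := by
    intro u
    have h1 : t ⬝ᵥ (D *ᵥ u) = zbar ⬝ᵥ u + B ⬝ᵥ u := by
      rw [dotProduct_mulVec, ← mulVec_transpose, hDt, add_dotProduct]
    have h2 : ∑ i, B i * u i = B ⬝ᵥ u := rfl
    rw [hf, h2, aux_sum_sq, aux_sum_sq, aux_sum_sq]
    simp only [add_dotProduct, dotProduct_add, smul_dotProduct, dotProduct_smul,
        smul_eq_mul, dotProduct_comm (D *ᵥ u) t, h1]
    ring
  have hval : f ((-c) • v) = -P₁ * c ^ 2 * ∑ i, t i ^ 2 := by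
    rw [hfu, mulVec_smul, hDv, dotProduct_smul, hvz]
    simp
  have hzu : ∀ u : Fin m → ℝ, (∀ i, 0 ≤ u i) → 0 ≤ -(2 * P₁ * c * (zbar ⬝ᵥ u)) := by
    intro u hu
    have h2 : 0 ≤ zbar ⬝ᵥ u := Finset.sum_nonneg fun i _ => mul_nonneg (hzbar i) (hu i)
    have h3 : 0 ≤ 2 * P₁ * (-c) := by
      have : 0 < -c := by linarith
      positivity
    have := mul_nonneg h3 h2
    linarith
  refine ⟨fun i => ?_, fun u hu => ?_, fun u hu h => ?_, hval⟩
  · exact mul_nonneg (by linarith) (hvn i)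
  · rw [hval, hfu]
    have h1 := hzu u hu
    have h2 : 0 ≤ P₁ * ∑ i, (D *ᵥ u + c • t) i ^ 2 := by positivity
    linarith
  · rw [hval, hfu] at h
    have h1 := hzu u hu
    have h2 : 0 ≤ ∑ i, (D *ᵥ u + c • t) i ^ 2 := by positivity
    have h3 : ∑ i, (D *ᵥ u + c • t) i ^ 2 = 0 := by
      apply le_antisymm _ h2
      by_contra! h4
      have := mul_pos hP₁ h4
      linarith
    rw [aux_sum_sq, dotProduct_self_eq_zero] at h3
    have h5 : D *ᵥ u = (-c) • t := by
      rw [neg_smul]; exact eq_neg_of_add_eq_zero_left h3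
    rw [hv, ← mulVec_smul, ← h5, mulVec_mulVec, nonsing_inv_mul _ hD, one_mulVec]
end

section
/- Let T > 0, let a, q, g be real constants and κ ≥ 0, and let P₁ : [0,T] → ℝ be continuous with P₁(t) > 0 for all t ∈ [0,T]. Suppose P₂ : [0,T] → ℝ is differentiable and solves the Riccati terminal value problem P₂'(t) = (κ/P₁(t)) P₂(t)² − 2a·P₂(t) − q on [0,T] with P₂(T) = g, and suppose P̃₂ : [0,T] → ℝ is differentiable and solves the linear terminal value problem P̃₂'(t) = −2a·P̃₂(t) − q on [0,T] with P̃₂(T) = g. Then P₂(t) ≤ P̃₂(t) for all t ∈ [0,T]. -/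
theorem riccati_comparison
    (T a q g κ : ℝ) (hT : 0 < T) (hκ : 0 ≤ κ)
    (P₁ : ℝ → ℝ)
    (hP₁cont : ContinuousOn P₁ (Set.Icc 0 T))
    (hP₁pos : ∀ t ∈ Set.Icc (0:ℝ) T, 0 < P₁ t)
    (P₂ P₂' Q₂ Q₂' : ℝ → ℝ)
    (hP₂d : ∀ t ∈ Set.Icc (0:ℝ) T, HasDerivAt P₂ (P₂' t) t)
    (hP₂ode : ∀ t ∈ Set.Icc (0:ℝ) T,
      P₂' t = κ / P₁ t * (P₂ t) ^ 2 - 2 * a * P₂ t - q)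
    (hP₂T : P₂ T = g)
    (hQ₂d : ∀ t ∈ Set.Icc (0:ℝ) T, HasDerivAt Q₂ (Q₂' t) t)
    (hQ₂ode : ∀ t ∈ Set.Icc (0:ℝ) T, Q₂' t = -2 * a * Q₂ t - q)
    (hQ₂T : Q₂ T = g) :
    ∀ t ∈ Set.Icc (0:ℝ) T, P₂ t ≤ Q₂ t := by
  have hD : ∀ t ∈ Set.Icc (0:ℝ) T,
      HasDerivAt (fun t => (P₂ t - Q₂ t) * Real.exp (2 * a * t))
        (κ / P₁ t * (P₂ t) ^ 2 * Real.exp (2 * a * t)) t := by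
    intro t ht
    have he : HasDerivAt (fun t : ℝ => Real.exp (2 * a * t))
        (Real.exp (2 * a * t) * (2 * a * 1)) t :=
      ((hasDerivAt_id t).const_mul (2 * a)).exp
    refine (((hP₂d t ht).sub (hQ₂d t ht)).mul he).congr_deriv ?_
    simp only [Pi.sub_apply]
    rw [hP₂ode t ht, hQ₂ode t ht]
    ring
  have hmono : MonotoneOn (fun t => (P₂ t - Q₂ t) * Real.exp (2 * a * t))
      (Set.Icc (0:ℝ) T) := by
    refine monotoneOn_of_deriv_nonneg (convex_Icc 0 T)
      (fun t ht => (hD t ht).continuousAt.continuousWithinAt)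
      (fun t ht => (hD t (interior_subset ht)).differentiableAt.differentiableWithinAt) ?_
    intro t ht
    have ht := interior_subset ht
    rw [(hD t ht).deriv]
    have := hP₁pos t ht
    positivity
  intro t ht
  have h := hmono ht (Set.right_mem_Icc.mpr hT.le) ht.2
  simp only [hP₂T, hQ₂T, sub_self, zero_mul] at h
  have := nonpos_of_mul_nonpos_left h (Real.exp_pos _)
  linarith
end

section
/- Let T > 0, let A + Ā > 0, b₀ ∈ ℝ, G₃ ∈ ℝ, G₁ + G₂ ≠ 0 and κ ≥ 0, and let P₁ : [0,T] → ℝ be continuous and strictly positive. Suppose P₂ : [0,T] → ℝ is differentiable, never vanishes, and solves P₂'(t) = (κ/P₁(t)) P₂(t)² − 2(A+Ā) P₂(t) with P₂(T) = G₁ + G₂, and suppose P₃ : [0,T] → ℝ is differentiable and solves P₃'(t) = −( A + Ā − (P₂(t)/P₁(t)) κ ) P₃(t) − 2 b₀ P₂(t) with P₃(T) = G₃. Then for every t ∈ [0,T], P₃(t)/P₂(t) = (G₃/(G₁+G₂)) e^{−(A+Ā)(T−t)} + (2b₀/(A+Ā)) (1 − e^{−(A+Ā)(T−t)}). -/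
theorem eta_explicit
    (T A Abar b₀ G₁ G₂ G₃ κ : ℝ) (hT : 0 < T)
    (hAsum : 0 < A + Abar) (hG : G₁ + G₂ ≠ 0) (hκ : 0 ≤ κ)
    (P₁ : ℝ → ℝ)
    (hP₁cont : ContinuousOn P₁ (Set.Icc 0 T))
    (hP₁pos : ∀ t ∈ Set.Icc (0:ℝ) T, 0 < P₁ t)
    (P₂ P₂' P₃ P₃' : ℝ → ℝ)
    (hP₂d : ∀ t ∈ Set.Icc (0:ℝ) T, HasDerivAt P₂ (P₂' t) t)
    (hP₂ne : ∀ t ∈ Set.Icc (0:ℝ) T, P₂ t ≠ 0)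
    (hP₂ode : ∀ t ∈ Set.Icc (0:ℝ) T,
      P₂' t = κ / P₁ t * (P₂ t) ^ 2 - 2 * (A + Abar) * P₂ t)
    (hP₂T : P₂ T = G₁ + G₂)
    (hP₃d : ∀ t ∈ Set.Icc (0:ℝ) T, HasDerivAt P₃ (P₃' t) t)
    (hP₃ode : ∀ t ∈ Set.Icc (0:ℝ) T,
      P₃' t = -(A + Abar - P₂ t / P₁ t * κ) * P₃ t - 2 * b₀ * P₂ t)
    (hP₃T : P₃ T = G₃) :
    ∀ t ∈ Set.Icc (0:ℝ) T,
      P₃ t / P₂ t = G₃ / (G₁ + G₂) * Real.exp (-(A + Abar) * (T - t))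
        + 2 * b₀ / (A + Abar) * (1 - Real.exp (-(A + Abar) * (T - t))) := by
  intro t ht
  have ha : A + Abar ≠ 0 := hAsum.ne'
  have key : ∀ s ∈ Set.Icc (0:ℝ) T, HasDerivAt
      (fun s => (P₃ s / P₂ s - 2 * b₀ / (A + Abar)) * Real.exp ((A + Abar) * (T - s))) 0 s := by
    intro s hs
    have h2 := hP₂ne s hs
    have h1 := (hP₁pos s hs).ne'
    have he : HasDerivAt (fun s => Real.exp ((A + Abar) * (T - s)))
        (Real.exp ((A + Abar) * (T - s)) * ((A + Abar) * (-1))) s :=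
      (((hasDerivAt_id s).const_sub T).const_mul (A + Abar)).exp
    have hd := (((hP₃d s hs).div (hP₂d s hs) h2).sub_const (2 * b₀ / (A + Abar))).mul he
    refine hd.congr_deriv ?_
    simp only [Pi.div_apply]
    rw [hP₂ode s hs, hP₃ode s hs]
    field_simp
    ring
  have hc := constant_of_has_deriv_right_zero
    (fun s hs => (key s hs).continuousAt.continuousWithinAt)
    (fun s hs => (key s (Set.Ico_subset_Icc_self hs)).hasDerivWithinAt)
  have e1 := hc t ht
  have e2 := hc T ⟨hT.le, le_rfl⟩
  rw [← e2] at e1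
  simp only [sub_self, mul_zero, Real.exp_zero, mul_one, hP₂T, hP₃T] at e1
  have hE : Real.exp ((A + Abar) * (T - t)) * Real.exp (-(A + Abar) * (T - t)) = 1 := by
    rw [← Real.exp_add, ← Real.exp_zero]
    congr 1
    ring
  linear_combination Real.exp (-(A + Abar) * (T - t)) * e1
    - (P₃ t / P₂ t - 2 * b₀ / (A + Abar)) * hE
end

section
/- Let T > 0, let A > 0, Ā > 0, b₀ ∈ ℝ, Q₁ ≥ 0, Q₂, G₂ ∈ ℝ with Q₁ + Q₂ ≥ 0, G₁ > 0 with G₁ + G₂ ≥ 0, G₃ ≤ 0, Q₃ ≤ 0, and κ ≥ 0. Let P₁, P̃₁ : [0,T] → ℝ be differentiable solutions of P'(t) + 2A P(t) + Q₁ = 0 with P(T) = G₁; let P₂ be a differentiable solution of P₂'(t) = (κ/P₁(t)) P₂(t)² − 2(A+Ā) P₂(t) − (Q₁+Q₂) with P₂(T) = G₁+G₂, and P̃₂ a differentiable solution of P̃₂'(t) = −2(A+Ā) P̃₂(t) − (Q₁+Q₂) with P̃₂(T) = G₁+G₂; let P₃ : [0,T] → ℝ be continuous and define P₄(t) := ∫ₜᵀ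 ( b₀ P₃(s) − (κ/4) P₃(s)²/P₁(s) ) ds and P̃₄(t) := ∫ₜᵀ b₀ P₃(s) ds. Then for all t ∈ [0,T]: 0 < P₁(t) = P̃₁(t) = G₁ e^{2A(T−t)} + (Q₁/(2A))(e^{2A(T−t)} − 1), P₂(t) ≤ P̃₂(t), and P₄(t) ≤ P̃₄(t). -/
open intervalIntegral

theorem aux_le (T c : ℝ) (f f' : ℝ → ℝ)
    (hd : ∀ t ∈ Set.Icc (0:ℝ) T, HasDerivAt f (f' t) t)
    (hi : ∀ t ∈ Set.Icc (0:ℝ) T, 0 ≤ f' t + c * f t) (hT : f T ≤ 0) :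
    ∀ t ∈ Set.Icc (0:ℝ) T, f t ≤ 0 := by
  have hg : ∀ t ∈ Set.Icc (0:ℝ) T, HasDerivAt (fun t => f t * Real.exp (c * t))
      (f' t * Real.exp (c * t) + f t * (Real.exp (c * t) * (c * 1))) t := fun t ht =>
    (hd t ht).mul (((hasDerivAt_id t).const_mul c).exp)
  have hm : MonotoneOn (fun t => f t * Real.exp (c * t)) (Set.Icc 0 T) := by
    apply monotoneOn_of_deriv_nonneg (convex_Icc 0 T)
    · exact fun t ht => (hg t ht).continuousAt.continuousWithinAt
    · exact fun t ht => (hg t (interior_subset ht)).differentiableAt.differentiableWithinAt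
    · intro t ht
      rw [(hg t (interior_subset ht)).deriv]
      have h1 := mul_nonneg (hi t (interior_subset ht)) (Real.exp_pos (c * t)).le
      linarith
  intro t ht
  have h2 := hm ht ⟨ht.1.trans ht.2, le_refl T⟩ ht.2
  simp only at h2
  have h3 : f T * Real.exp (c * T) ≤ 0 := mul_nonpos_of_nonpos_of_nonneg hT (Real.exp_pos _).le
  by_contra h
  push Not at h
  have := mul_pos h (Real.exp_pos (c * t))
  linarith

theorem aux_formula (T A Q₁ G₁ : ℝ) (hA : 0 < A) (P P' : ℝ → ℝ)
    (hd : ∀ t ∈ Set.Icc (0:ℝ) T, HasDerivAt P (P' t) t)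
    (hode : ∀ t ∈ Set.Icc (0:ℝ) T, P' t + 2 * A * P t + Q₁ = 0)
    (hT : P T = G₁) : ∀ t ∈ Set.Icc (0:ℝ) T,
      P t = G₁ * Real.exp (2 * A * (T - t))
          + Q₁ / (2 * A) * (Real.exp (2 * A * (T - t)) - 1) := by
  have hE : ∀ t : ℝ, HasDerivAt (fun t => G₁ * Real.exp (2 * A * (T - t))
          + Q₁ / (2 * A) * (Real.exp (2 * A * (T - t)) - 1))
      (G₁ * (Real.exp (2 * A * (T - t)) * (2 * A * (-1)))
        + Q₁ / (2 * A) * (Real.exp (2 * A * (T - t)) * (2 * A * (-1)))) t := by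
    intro t
    have h := (((hasDerivAt_id t).const_sub T).const_mul (2 * A)).exp
    exact (h.const_mul G₁).add ((h.sub_const 1).const_mul (Q₁ / (2 * A)))
  have hq : Q₁ / (2 * A) * (2 * A) = Q₁ := by field_simp
  have h1 := aux_le T (2 * A) _ _ (fun t ht => (hd t ht).sub (hE t))
    (fun t ht => by
      have := hode t ht
      simp only [Pi.sub_apply]
      apply le_of_eq
      linear_combination (-1) * this - hq) (by simp [hT])
  have h2 := aux_le T (2 * A) _ _ (fun t ht => (hE t).sub (hd t ht))
    (fun t ht => by
      have := hode t ht
      simp only [Pi.sub_apply]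
      apply le_of_eq
      linear_combination this + hq) (by simp [hT])
  intro t ht
  have a := h1 t ht
  have b := h2 t ht
  simp only [Pi.sub_apply] at a b
  linarith

theorem switching_curve_comparison
    (T A Abar b₀ Q₁ Q₂ Q₃ G₁ G₂ G₃ κ : ℝ)
    (hT : 0 < T) (hA : 0 < A) (hAbar : 0 < Abar)
    (hQ₁ : 0 ≤ Q₁) (hQ₁₂ : 0 ≤ Q₁ + Q₂) (hQ₃ : Q₃ ≤ 0)
    (hG₁ : 0 < G₁) (hG₁₂ : 0 ≤ G₁ + G₂) (hG₃ : G₃ ≤ 0) (hκ : 0 ≤ κ)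
    (P₁ P₁' Pt₁ Pt₁' : ℝ → ℝ)
    (hP₁d : ∀ t ∈ Set.Icc (0:ℝ) T, HasDerivAt P₁ (P₁' t) t)
    (hP₁ode : ∀ t ∈ Set.Icc (0:ℝ) T, P₁' t + 2 * A * P₁ t + Q₁ = 0)
    (hP₁T : P₁ T = G₁)
    (hPt₁d : ∀ t ∈ Set.Icc (0:ℝ) T, HasDerivAt Pt₁ (Pt₁' t) t)
    (hPt₁ode : ∀ t ∈ Set.Icc (0:ℝ) T, Pt₁' t + 2 * A * Pt₁ t + Q₁ = 0)
    (hPt₁T : Pt₁ T = G₁)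
    (P₂ P₂' Pt₂ Pt₂' : ℝ → ℝ)
    (hP₂d : ∀ t ∈ Set.Icc (0:ℝ) T, HasDerivAt P₂ (P₂' t) t)
    (hP₂ode : ∀ t ∈ Set.Icc (0:ℝ) T,
      P₂' t = κ / P₁ t * (P₂ t) ^ 2 - 2 * (A + Abar) * P₂ t - (Q₁ + Q₂))
    (hP₂T : P₂ T = G₁ + G₂)
    (hPt₂d : ∀ t ∈ Set.Icc (0:ℝ) T, HasDerivAt Pt₂ (Pt₂' t) t)
    (hPt₂ode : ∀ t ∈ Set.Icc (0:ℝ) T,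
      Pt₂' t = -2 * (A + Abar) * Pt₂ t - (Q₁ + Q₂))
    (hPt₂T : Pt₂ T = G₁ + G₂)
    (P₃ : ℝ → ℝ) (hP₃cont : ContinuousOn P₃ (Set.Icc 0 T)) :
    ∀ t ∈ Set.Icc (0:ℝ) T,
      (0 < P₁ t ∧ P₁ t = Pt₁ t ∧
        P₁ t = G₁ * Real.exp (2 * A * (T - t))
          + Q₁ / (2 * A) * (Real.exp (2 * A * (T - t)) - 1)) ∧
      P₂ t ≤ Pt₂ t ∧
      (∫ s in t..T, (b₀ * P₃ s - κ / 4 * (P₃ s) ^ 2 / P₁ s)) ≤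
        ∫ s in t..T, b₀ * P₃ s := by
  have hF := aux_formula T A Q₁ G₁ hA P₁ P₁' hP₁d hP₁ode hP₁T
  have hFt := aux_formula T A Q₁ G₁ hA Pt₁ Pt₁' hPt₁d hPt₁ode hPt₁T
  have hpos : ∀ t ∈ Set.Icc (0:ℝ) T, 0 < P₁ t := by
    intro t ht
    rw [hF t ht]
    have h1 : 1 ≤ Real.exp (2 * A * (T - t)) :=
      Real.one_le_exp (mul_nonneg (by linarith) (sub_nonneg.2 ht.2))
    have h2 : 0 ≤ Q₁ / (2 * A) * (Real.exp (2 * A * (T - t)) - 1) :=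
      mul_nonneg (div_nonneg hQ₁ (by linarith)) (by linarith)
    have h3 := mul_pos hG₁ (Real.exp_pos (2 * A * (T - t)))
    linarith
  have h2 := aux_le T (2 * (A + Abar)) _ _ (fun t ht => (hP₂d t ht).sub (hPt₂d t ht))
    (fun t ht => by
      have h := mul_nonneg (div_nonneg hκ (hpos t ht).le) (sq_nonneg (P₂ t))
      simp only [Pi.sub_apply]
      rw [hP₂ode t ht, hPt₂ode t ht]
      linarith) (by simp [hP₂T, hPt₂T])
  intro t ht
  refine ⟨⟨hpos t ht, (hF t ht).trans (hFt t ht).symm, hF t ht⟩, ?_, ?_⟩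
  · have := h2 t ht
    simp only [Pi.sub_apply] at this
    linarith
  · have hsub : Set.Icc t T ⊆ Set.Icc 0 T := Set.Icc_subset_Icc_left ht.1
    have c3 : ContinuousOn P₃ (Set.Icc t T) := hP₃cont.mono hsub
    have c1 : ContinuousOn P₁ (Set.Icc t T) := fun s hs =>
      (hP₁d s (hsub hs)).continuousAt.continuousWithinAt
    have c4 : ContinuousOn (fun s => b₀ * P₃ s) (Set.Icc t T) := continuousOn_const.mul c3
    apply intervalIntegral.integral_mono_on ht.2
    · apply ContinuousOn.intervalIntegrable_of_Icc ht.2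
      exact c4.sub ((continuousOn_const.mul (c3.pow 2)).div c1
        (fun s hs => (hpos s (hsub hs)).ne'))
    · exact c4.intervalIntegrable_of_Icc ht.2
    · intro s hs
      have : 0 ≤ κ / 4 * (P₃ s) ^ 2 / P₁ s :=
        div_nonneg (mul_nonneg (by linarith) (sq_nonneg _)) (hpos s (hsub hs)).le
      linarith
end
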